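/- Let g_k = e^{2u_k} g_euc be smooth conformal metrics on ℝ² with u_k = 0 outside D_2, u_k converging weakly to u₀ in W^{1,p}(D_2) for every p ∈ (1,2), ∫_D |K(g_k)| dμ_{g_k} < ε₀, and suppose the distance functions d_{g_k} converge uniformly on D × D to d₀. Then d₀ is a distance function (in particular d₀(x,y) = 0 implies x = y), and for every δ > 0 there exists a(δ) > 0 such that d₀(x, y) > a(δ) whenever |x − y| ≥ δ; equivalently, the Euclidean distance (x,y) ↦ |x − y| is continuous with respect to d₀. -/

import Mathlib

open MeasureTheory Filter Metric
open scoped Topology ENNReal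

noncomputable section

/-- The Laplacian of `u : ℂ → ℝ` (sum of the two pure second derivatives). -/
def lap (u : ℂ → ℝ) (x : ℂ) : ℝ :=
  iteratedFDeriv ℝ 2 u x ![1, 1] + iteratedFDeriv ℝ 2 u x ![Complex.I, Complex.I]

/-- Gauss curvature of the conformal metric `e^{2u} g_euc`: `K = -e^{-2u} Δu`. -/
def gauss (u : ℂ → ℝ) (x : ℂ) : ℝ := -Real.exp (-(2 * u x)) * lap u x

/-- Area `μ(A, g)` of a set for the metric `g = e^{2u} g_euc`. -/
def confAreaE (u : ℂ → ℝ) (A : Set ℂ) : ℝ≥0∞ :=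
  ∫⁻ x in A, ENNReal.ofReal (Real.exp (2 * u x))

/-- Total curvature `∫_A |K(g)| dμ_g` of the metric `g = e^{2u} g_euc`. -/
def curvIntE (u : ℂ → ℝ) (A : Set ℂ) : ℝ≥0∞ :=
  ∫⁻ x in A, ENNReal.ofReal (|gauss u x| * Real.exp (2 * u x))

/-- `C¹` paths from `x` to `y` staying in `S`. -/
def PathsIn (S : Set ℂ) (x y : ℂ) : Set (ℝ → ℂ) :=
  {γ | γ 0 = x ∧ γ 1 = y ∧ (∀ t ∈ Set.Icc (0:ℝ) 1, γ t ∈ S) ∧ ContDiff ℝ 1 γ}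

/-- Length of a path for the metric `e^{2u} g_euc`. -/
def confLen (u : ℂ → ℝ) (γ : ℝ → ℂ) : ℝ :=
  ∫ t in (0:ℝ)..1, Real.exp (u (γ t)) * ‖deriv γ t‖

/-- Geodesic distance (within `S`) of the conformal metric `e^{2u} g_euc`. -/
def confDist (u : ℂ → ℝ) (S : Set ℂ) (x y : ℂ) : ℝ :=
  sInf (confLen u '' PathsIn S x y)

/-- Metric ball `B_r^g(z)` of the conformal metric (within `S`). -/
def confBall (u : ℂ → ℝ) (S : Set ℂ) (z : ℂ) (r : ℝ) : Set ℂ :=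
  {x ∈ S | confDist u S z x < r}

/-- `‖f‖_{L^{2,∞}(Ω)} ≤ C`, i.e. `t·|{|f| > t}|^{1/2} ≤ C` for all `t > 0`. -/
def wL2Bound (f : ℂ → ℝ) (Ω : Set ℂ) (C : ℝ) : Prop :=
  ∀ t : ℝ, 0 < t → t * (volume {x ∈ Ω | t < |f x|}).toReal ^ ((1:ℝ)/2) ≤ C

/-- The `W^{1,p}(Ω)` norm of a differentiable function (via its classical gradient). -/
def w1pNormE (u : ℂ → ℝ) (Ω : Set ℂ) (p : ℝ) : ℝ≥0∞ :=
  (∫⁻ x in Ω, ENNReal.ofReal (|u x| ^ p)) ^ (1/p)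
    + (∫⁻ x in Ω, ENNReal.ofReal (‖fderiv ℝ u x‖ ^ p)) ^ (1/p)

/-- Real dot product on `ℂ = ℝ²`. -/
def dotC (a b : ℂ) : ℝ := a.re * b.re + a.im * b.im

/-- `V` is the distributional (weak) gradient of `u` on `Ω`. -/
def IsWeakGradOn (Ω : Set ℂ) (u : ℂ → ℝ) (V : ℂ → ℂ) : Prop :=
  ∀ φ : ℂ → ℝ, ContDiff ℝ (⊤ : ℕ∞) φ → HasCompactSupport φ → tsupport φ ⊆ Ω →
    ∀ w : ℂ, ∫ x in Ω, u x * fderiv ℝ φ x w = -∫ x in Ω, dotC (V x) w * φ x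

/-- `v k → u` weakly in `W^{1,p}(Ω)`: uniformly bounded `W^{1,p}` norms together with
convergence, tested against smooth compactly supported functions, of the functions and of
their weak gradients. -/
def WeakW1pLim (Ω : Set ℂ) (p : ℝ) (v : ℕ → ℂ → ℝ) (u : ℂ → ℝ) : Prop :=
  ∃ V : ℕ → ℂ → ℂ,
    (∀ k, IsWeakGradOn Ω (v k) (V k)) ∧
    (∃ C : ℝ, ∀ k, (∫ x in Ω, |v k x| ^ p) ^ (1/p)
        + (∫ x in Ω, ‖V k x‖ ^ p) ^ (1/p) ≤ C) ∧
    (∀ φ : ℂ → ℝ, ContDiff ℝ (⊤ : ℕ∞) φ → HasCompactSupport φ → tsupport φ ⊆ Ω →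
      Tendsto (fun k => ∫ x in Ω, v k x * φ x) atTop (𝓝 (∫ x in Ω, u x * φ x)) ∧
      ∀ w : ℂ, Tendsto (fun k => ∫ x in Ω, dotC (V k x) w * φ x) atTop
        (𝓝 (-∫ x in Ω, u x * fderiv ℝ φ x w)))

/-- Mean value of `φ` on a set. -/
def avgOn (φ : ℂ → ℝ) (A : Set ℂ) : ℝ := (volume A).toReal⁻¹ * ∫ x in A, φ x

/-- Mean oscillation of `φ` on the disk `D_t(x₀)`. -/
def meanOsc (φ : ℂ → ℝ) (x₀ : ℂ) (t : ℝ) : ℝ :=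
  avgOn (fun x => |φ x - avgOn φ (ball x₀ t)|) (ball x₀ t)

/-- The John–Nirenberg radius `ρ(φ, x₀, Ω, λ)`. -/
def jnRad (φ : ℂ → ℝ) (x₀ : ℂ) (Ω : Set ℂ) (lam : ℝ) : ℝ :=
  sSup {r : ℝ | 0 ≤ r ∧ ∀ t : ℝ, 0 < t → t < r → ball x₀ t ⊆ Ω ∧ meanOsc φ x₀ t ≤ lam}

/-- Mean value of `u` along the circle `∂D_r(0)`. -/
def circMean (u : ℂ → ℝ) (r : ℝ) : ℝ :=
  (2 * Real.pi)⁻¹ * ∫ θ in (0:ℝ)..(2 * Real.pi), u ((r : ℂ) * Complex.exp ((θ : ℂ) * Complex.I))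

/-- Completeness of the conformal metric `e^{2v} g_euc` on all of `ℂ`. -/
def ConfComplete (v : ℂ → ℝ) : Prop :=
  ∀ x : ℕ → ℂ,
    (∀ ε : ℝ, 0 < ε → ∃ N : ℕ, ∀ m ≥ N, ∀ n ≥ N, confDist v Set.univ (x m) (x n) < ε) →
    ∃ l : ℂ, Tendsto (fun n => confDist v Set.univ (x n) l) atTop (𝓝 0)

/-- `(D, g_k)` extends to a complete conformal surface with total curvature at most `Λ`. -/
def ExtendsComplete (u : ℂ → ℝ) (Λ : ℝ) : Prop :=
  ∃ v : ℂ → ℝ, ContDiff ℝ (⊤ : ℕ∞) v ∧ Set.EqOn v u (ball (0:ℂ) 1) ∧ ConfComplete v ∧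
    curvIntE v Set.univ ≤ ENNReal.ofReal Λ

/-- Gromov–Hausdorff convergence of `(S, dk k)` to `(S, d)`, phrased through
correspondences of small distortion. -/
def GHTendsto (S : Set ℂ) (dk : ℕ → ℂ → ℂ → ℝ) (d : ℂ → ℂ → ℝ) : Prop :=
  ∀ ε : ℝ, 0 < ε → ∀ᶠ k in atTop, ∃ R : Set (ℂ × ℂ),
    (∀ p ∈ R, p.1 ∈ S ∧ p.2 ∈ S) ∧
    (∀ x ∈ S, ∃ y ∈ S, (x, y) ∈ R) ∧
    (∀ y ∈ S, ∃ x ∈ S, (x, y) ∈ R) ∧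
    (∀ p ∈ R, ∀ q ∈ R, |dk k p.1 q.1 - d p.2 q.2| < ε)

/-- `−Δu = f` on `Ω` in the sense of distributions. -/
def DistribLaplaceEq (Ω : Set ℂ) (u f : ℂ → ℝ) : Prop :=
  ∀ φ : ℂ → ℝ, ContDiff ℝ (⊤ : ℕ∞) φ → HasCompactSupport φ → tsupport φ ⊆ Ω →
    -∫ x in Ω, u x * lap φ x = ∫ x in Ω, f x * φ x


lemma slice_bound (u : ℂ → ℝ) (hu : ContDiff ℝ (⊤ : ℕ∞) u)
    (h0 : ∀ x : ℂ, x ∉ ball (0:ℂ) 2 → u x = 0) (e f : ℂ)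
    (hb : ∀ a b : ℝ, |b| ≤ ‖a • e + b • f‖)
    (hI : ∀ F : ℂ → ℝ, Continuous F → HasCompactSupport F →
      Integrable (fun q : ℝ × ℝ => F (q.1 • e + q.2 • f)) ∧
      ∫ q : ℝ × ℝ, F (q.1 • e + q.2 • f) = ∫ z, F z) :
    ∃ G : ℝ → ℝ, Continuous G ∧ (∀ a b : ℝ, |u (a • e + b • f)| ≤ G a) ∧
      ∀ s t : ℝ, s ≤ t → ∫ a in s..t, G a ≤ ∫ z, |fderiv ℝ u z f| := by
  have hd : Differentiable ℝ u := hu.differentiable (by simp)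
  have hc : Continuous (fun z => fderiv ℝ u z f) :=
    (hu.continuous_fderiv (by simp)).clm_apply continuous_const
  have hcs : HasCompactSupport u := by
    refine HasCompactSupport.intro (isCompact_closedBall (0:ℂ) 2) ?_
    intro x hx
    exact h0 x (fun h => hx (ball_subset_closedBall h))
  have hcs' : HasCompactSupport (fun z => |fderiv ℝ u z f|) := by
    have := hcs.fderiv_apply (𝕜 := ℝ) f
    exact this.comp_left (g := fun x : ℝ => |x|) abs_zero
  obtain ⟨hint, heq⟩ := hI _ hc.abs hcs'
  have hcl : Continuous (fun q : ℝ × ℝ => |fderiv ℝ u (q.1 • e + q.2 • f) f|) := by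
    have : Continuous (fun q : ℝ × ℝ => q.1 • e + q.2 • f) := by fun_prop
    exact (hc.comp this).abs
  have hz : ∀ a b : ℝ, 2 ≤ |b| → u (a • e + b • f) = 0 := by
    intro a b h
    apply h0
    simp only [mem_ball_zero_iff, not_lt]
    exact h.trans (hb a b)
  refine ⟨fun a => ∫ b in (-2:ℝ)..2, |fderiv ℝ u (a • e + b • f) f|, ?_, ?_, ?_⟩
  · exact intervalIntegral.continuous_parametric_intervalIntegral_of_continuous' hcl _ _
  · intro a b
    have hca : Continuous (fun b : ℝ => |fderiv ℝ u (a • e + b • f) f|) :=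
      hcl.comp (by fun_prop : Continuous fun b : ℝ => (a, b))
    have hca' : Continuous (fun b : ℝ => fderiv ℝ u (a • e + b • f) f) :=
      hc.comp (by fun_prop)
    by_cases hb2 : 2 ≤ |b|
    · rw [hz a b hb2, abs_zero]
      exact intervalIntegral.integral_nonneg (by norm_num) (fun _ _ => abs_nonneg _)
    · push Not at hb2
      have hb3 := abs_lt.1 hb2
      have hder : ∀ t : ℝ, HasDerivAt (fun t : ℝ => u (a • e + t • f))
          (fderiv ℝ u (a • e + t • f) f) t := by
        intro t
        have h1 : HasDerivAt (fun t : ℝ => a • e + t • f) f t := by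
          simpa using ((hasDerivAt_id t).smul_const f).const_add (a • e)
        exact (hd _).hasFDerivAt.comp_hasDerivAt t h1
      have hftc : ∫ t in (-2:ℝ)..b, fderiv ℝ u (a • e + t • f) f = u (a • e + b • f) := by
        rw [intervalIntegral.integral_eq_sub_of_hasDerivAt (fun t _ => hder t)
          (hca'.intervalIntegrable _ _), hz a (-2) (by norm_num), sub_zero]
      rw [← hftc]
      refine (intervalIntegral.abs_integral_le_integral_abs hb3.1.le).trans ?_
      refine intervalIntegral.integral_mono_interval le_rfl hb3.1.le hb3.2.le
        (Eventually.of_forall fun _ => abs_nonneg _) (hca.intervalIntegrable _ _)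
  · intro s t hst
    rw [← heq, intervalIntegral.integral_of_le hst]
    simp only [intervalIntegral.integral_of_le (show (-2:ℝ) ≤ 2 by norm_num)]
    rw [← setIntegral_prod (fun q : ℝ × ℝ => |fderiv ℝ u (q.1 • e + q.2 • f) f|)
      hint.integrableOn]
    exact setIntegral_le_integral hint (Eventually.of_forall fun _ => abs_nonneg _)

lemma coordI (F : ℂ → ℝ) (hF : Continuous F) (hs : HasCompactSupport F) :
      Integrable (fun q : ℝ × ℝ => F (q.1 • (1:ℂ) + q.2 • Complex.I)) ∧
      ∫ q : ℝ × ℝ, F (q.1 • (1:ℂ) + q.2 • Complex.I) = ∫ z, F z := by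
  have hP := Complex.volume_preserving_equiv_real_prod.symm
  have he : (fun q : ℝ × ℝ => F (q.1 • (1:ℂ) + q.2 • Complex.I)) =
      F ∘ Complex.measurableEquivRealProd.symm := by
    funext q
    simp only [Function.comp]
    congr 1
    apply Complex.ext <;> simp [Complex.measurableEquivRealProd]
  constructor
  · rw [he]
    exact (hP.integrable_comp_emb (MeasurableEquiv.measurableEmbedding _)).2
      (hF.integrable_of_hasCompactSupport hs)
  · rw [he]
    exact hP.integral_comp (MeasurableEquiv.measurableEmbedding _) F

lemma coord1 (F : ℂ → ℝ) (hF : Continuous F) (hs : HasCompactSupport F) :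
      Integrable (fun q : ℝ × ℝ => F (q.1 • Complex.I + q.2 • (1:ℂ))) ∧
      ∫ q : ℝ × ℝ, F (q.1 • Complex.I + q.2 • (1:ℂ)) = ∫ z, F z := by
  obtain ⟨h1, h2⟩ := coordI F hF hs
  have he : (fun q : ℝ × ℝ => F (q.1 • Complex.I + q.2 • (1:ℂ))) =
      fun q : ℝ × ℝ => (fun q : ℝ × ℝ => F (q.1 • (1:ℂ) + q.2 • Complex.I)) q.swap := by
    funext q
    simp [add_comm]
  rw [he]
  refine ⟨h1.swap, ?_⟩
  rw [← h2]
  exact integral_prod_swap (μ := (volume : Measure ℝ)) (ν := (volume : Measure ℝ))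
    (fun q : ℝ × ℝ => F (q.1 • (1:ℂ) + q.2 • Complex.I))

lemma len_lower (u : ℂ → ℝ) (hu : Continuous u) (π : ℂ →L[ℝ] ℝ) (hπ : ∀ z, |π z| ≤ ‖z‖)
    (G : ℝ → ℝ) (hG : Continuous G) (hGu : ∀ z, |u z| ≤ G (π z)) (B A : ℝ)
    (hGB : ∀ s t : ℝ, s ≤ t → ∫ a in s..t, G a ≤ B) (γ : ℝ → ℂ) (hγ : ContDiff ℝ 1 γ) :
    Real.exp (-A) * (|π (γ 1) - π (γ 0)| * (1 + A) - B) ≤ confLen u γ := by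
  have hγc := hγ.continuous
  have hγ'c : Continuous (deriv γ) := hγ.continuous_deriv le_rfl
  have hγd : Differentiable ℝ γ := hγ.differentiable (by simp)
  have hder : ∀ t, HasDerivAt (fun t => π (γ t)) (π (deriv γ t)) t := fun t =>
    π.hasFDerivAt.comp_hasDerivAt t (hγd t).hasDerivAt
  set E : ℝ → ℝ := fun a => Real.exp (-G a) with hE
  have hEc : Continuous E := by fun_prop
  have hsub : ∫ t in (0:ℝ)..1, (E ∘ fun t => π (γ t)) t * π (deriv γ t)
      = ∫ a in π (γ 0)..π (γ 1), E a :=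
    intervalIntegral.integral_comp_mul_deriv (fun t _ => hder t)
      (by fun_prop) hEc
  have h1 : |∫ a in π (γ 0)..π (γ 1), E a| ≤ confLen u γ := by
    rw [← hsub]
    refine (intervalIntegral.abs_integral_le_integral_abs zero_le_one).trans ?_
    refine intervalIntegral.integral_mono_on zero_le_one
      (Continuous.intervalIntegrable (by fun_prop) _ _)
      (Continuous.intervalIntegrable (by fun_prop) _ _) ?_
    intro t _
    rw [abs_mul]
    simp only [Function.comp, hE, Real.abs_exp]
    gcongr
    · have := (abs_le.1 (hGu (γ t))).1
      linarith
    · exact hπ _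
  refine le_trans ?_ h1
  have key : ∀ s t : ℝ, s ≤ t →
      Real.exp (-A) * ((t - s) * (1 + A) - B) ≤ ∫ a in s..t, E a := by
    intro s t hst
    have : ∫ a in s..t, Real.exp (-A) * ((1 + A) - G a) ≤ ∫ a in s..t, E a := by
      refine intervalIntegral.integral_mono_on hst
        (Continuous.intervalIntegrable (by fun_prop) _ _)
        (Continuous.intervalIntegrable (by fun_prop) _ _) ?_
      intro a _
      have h2 : E a = Real.exp (-A) * Real.exp (A - G a) := by
        rw [← Real.exp_add]; simp only [hE]; congr 1; ring
      rw [h2]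
      have := Real.add_one_le_exp (A - G a)
      gcongr
      linarith
    refine le_trans ?_ this
    rw [intervalIntegral.integral_const_mul, intervalIntegral.integral_sub
      (Continuous.intervalIntegrable (by fun_prop) _ _) (hG.intervalIntegrable _ _),
      intervalIntegral.integral_const, smul_eq_mul]
    have := hGB s t hst
    gcongr
  rcases le_total (π (γ 0)) (π (γ 1)) with h | h
  · rw [abs_of_nonneg (sub_nonneg.2 h)]
    exact (key _ _ h).trans (le_abs_self _)
  · rw [abs_of_nonpos (sub_nonpos.2 h), intervalIntegral.integral_symm, abs_neg, neg_sub]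
    exact (key _ _ h).trans (le_abs_self _)

lemma confLen_nonneg (u : ℂ → ℝ) (γ : ℝ → ℂ) : 0 ≤ confLen u γ :=
  intervalIntegral.integral_nonneg zero_le_one (fun _ _ => by positivity)

lemma pathsIn_nonempty (x y : ℂ) : (PathsIn Set.univ x y).Nonempty := by
  refine ⟨fun t => x + (t:ℂ) * (y - x), by simp, by simp, fun _ _ => Set.mem_univ _, ?_⟩
  exact contDiff_const.add (Complex.ofRealCLM.contDiff.mul contDiff_const)

lemma confLen_bdd (u : ℂ → ℝ) (x y : ℂ) : BddBelow (confLen u '' PathsIn Set.univ x y) := by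
  refine ⟨0, ?_⟩
  rintro _ ⟨γ, _, rfl⟩
  exact confLen_nonneg u γ

lemma confDist_nonneg' (u : ℂ → ℝ) (x y : ℂ) : 0 ≤ confDist u Set.univ x y := by
  apply Real.sInf_nonneg
  rintro _ ⟨γ, _, rfl⟩
  exact confLen_nonneg u γ

lemma confDist_le (u : ℂ → ℝ) {x y : ℂ} {γ : ℝ → ℂ} (h : γ ∈ PathsIn Set.univ x y) :
    confDist u Set.univ x y ≤ confLen u γ :=
  csInf_le (confLen_bdd u x y) ⟨γ, h, rfl⟩

lemma confDist_ge (u : ℂ → ℝ) {x y : ℂ} {c : ℝ}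
    (h : ∀ γ ∈ PathsIn Set.univ x y, c ≤ confLen u γ) : c ≤ confDist u Set.univ x y := by
  refine le_csInf ((pathsIn_nonempty x y).image _) ?_
  rintro _ ⟨γ, hγ, rfl⟩
  exact h γ hγ

lemma confDist_self' (u : ℂ → ℝ) (x : ℂ) : confDist u Set.univ x x = 0 := by
  refine le_antisymm ?_ (confDist_nonneg' u x x)
  have h : (fun _ : ℝ => x) ∈ PathsIn Set.univ x x :=
    ⟨rfl, rfl, fun _ _ => Set.mem_univ _, contDiff_const⟩
  refine (confDist_le u h).trans ?_
  simp [confLen]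

lemma confDist_symm_le (u : ℂ → ℝ) (x y : ℂ) :
    confDist u Set.univ x y ≤ confDist u Set.univ y x := by
  apply confDist_ge
  rintro γ ⟨h0, h1, -, hc⟩
  have h : (fun t : ℝ => γ (1 - t)) ∈ PathsIn Set.univ x y :=
    ⟨by simpa using h1, by simpa using h0, fun _ _ => Set.mem_univ _,
      hc.comp (contDiff_const.sub contDiff_id)⟩
  refine (confDist_le u h).trans (le_of_eq ?_)
  unfold confLen
  have : ∀ t : ℝ, deriv (fun t : ℝ => γ (1 - t)) t = - deriv γ (1 - t) := fun t =>
    deriv_comp_const_sub γ 1 t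
  simp only [this, norm_neg]
  simpa using intervalIntegral.integral_comp_sub_left
    (fun t => Real.exp (u (γ t)) * ‖deriv γ t‖) (a := 0) (b := 1) (1:ℝ)

/-- Length of a monotone reparametrization of a path. -/
lemma len_reparam (u : ℂ → ℝ) (hu : Continuous u) (γ : ℝ → ℂ) (hγ : ContDiff ℝ 1 γ)
    (σ : ℝ → ℝ) (hσ : ContDiff ℝ 1 σ) (hm : Monotone σ) (a b : ℝ)
    (η : ℝ → ℂ) (hη : ∀ t ∈ Set.Ioo a b, η t = γ (σ t)) (hab : a ≤ b)
    (ha : σ a = 0) (hb : σ b = 1) :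
    ∫ t in a..b, Real.exp (u (η t)) * ‖deriv η t‖ = confLen u γ := by
  have hγ'c : Continuous (deriv γ) := hγ.continuous_deriv le_rfl
  have hγd : Differentiable ℝ γ := hγ.differentiable (by simp)
  have hγc := hγ.continuous
  have hσd : Differentiable ℝ σ := hσ.differentiable (by simp)
  have hσ'c : Continuous (deriv σ) := hσ.continuous_deriv le_rfl
  have h1 := intervalIntegral.integral_comp_mul_deriv (a := a) (b := b) (f := σ) (f' := deriv σ)
    (g := fun t => Real.exp (u (γ t)) * ‖deriv γ t‖) (fun t _ => (hσd t).hasDerivAt)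
    hσ'c.continuousOn (by fun_prop)
  rw [ha, hb] at h1
  unfold confLen
  rw [← h1, intervalIntegral.integral_of_le hab, intervalIntegral.integral_of_le hab,
    ← integral_Ioc_eq_integral_Ioo.symm, ← integral_Ioc_eq_integral_Ioo.symm]
  refine setIntegral_congr_fun measurableSet_Ioo ?_
  intro t ht
  have hev : η =ᶠ[𝓝 t] fun t => γ (σ t) := by
    filter_upwards [isOpen_Ioo.mem_nhds ht] with s hs using hη s hs
  have hd : deriv (fun t => γ (σ t)) t = deriv σ t • deriv γ (σ t) :=
    ((hγd (σ t)).hasDerivAt.scomp t (hσd t).hasDerivAt).deriv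
  simp only [Function.comp]
  rw [hη t ht, hev.deriv_eq, hd, norm_smul, Real.norm_of_nonneg hm.deriv_nonneg]
  ring

lemma confDist_triangle' (u : ℂ → ℝ) (hu : Continuous u) (x y z : ℂ) :
    confDist u Set.univ x z ≤ confDist u Set.univ x y + confDist u Set.univ y z := by
  rw [← sub_le_iff_le_add]
  apply confDist_ge
  rintro γ₁ ⟨h10, h11, -, hc1⟩
  rw [sub_le_iff_le_add, ← sub_le_iff_le_add']
  apply confDist_ge
  rintro γ₂ ⟨h20, h21, -, hc2⟩
  rw [sub_le_iff_le_add']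
  set S := Real.smoothTransition with hS
  have hSc : ContDiff ℝ 1 S := Real.smoothTransition.contDiff (n := 1)
  have hs1 : ContDiff ℝ 1 (fun t : ℝ => S (2 * t)) :=
    hSc.comp (contDiff_const.mul contDiff_id)
  have hs2 : ContDiff ℝ 1 (fun t : ℝ => S (2 * t - 1)) :=
    hSc.comp ((contDiff_const.mul contDiff_id).sub contDiff_const)
  have hm1 : Monotone (fun t : ℝ => S (2 * t)) := fun a b h =>
    Real.smoothTransition.monotone (by linarith)
  have hm2 : Monotone (fun t : ℝ => S (2 * t - 1)) := fun a b h =>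
    Real.smoothTransition.monotone (by linarith)
  set η : ℝ → ℂ := fun t => γ₁ (S (2 * t)) + γ₂ (S (2 * t - 1)) - y with hη
  have hηc : ContDiff ℝ 1 η := ((hc1.comp hs1).add (hc2.comp hs2)).sub contDiff_const
  have e1 : ∀ t ≤ (1/2 : ℝ), η t = γ₁ (S (2 * t)) := by
    intro t ht
    have : S (2 * t - 1) = 0 := Real.smoothTransition.zero_of_nonpos (by linarith)
    simp [hη, this, h20]
  have e2 : ∀ t ≥ (1/2 : ℝ), η t = γ₂ (S (2 * t - 1)) := by
    intro t ht
    have : S (2 * t) = 1 := Real.smoothTransition.one_of_one_le (by linarith)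
    simp [hη, this, h11]
  have hmem : η ∈ PathsIn Set.univ x z := by
    refine ⟨?_, ?_, fun _ _ => Set.mem_univ _, hηc⟩
    · rw [e1 0 (by norm_num)]; simp [hS, h10]
    · rw [e2 1 (by norm_num)]; norm_num [hS, h21]
  refine (confDist_le u hmem).trans (le_of_eq ?_)
  have hη'c : Continuous (deriv η) := hηc.continuous_deriv le_rfl
  have hηcc := hηc.continuous
  have hF : Continuous (fun t => Real.exp (u (η t)) * ‖deriv η t‖) := by fun_prop
  have l1 := len_reparam u hu γ₁ hc1 _ hs1 hm1 0 (1/2) η (fun t ht => e1 t ht.2.le) (by norm_num)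
    (by simp [hS]) (by norm_num [hS])
  have l2 := len_reparam u hu γ₂ hc2 _ hs2 hm2 (1/2) 1 η (fun t ht => e2 t ht.1.le) (by norm_num)
    (by norm_num [hS]) (by norm_num [hS])
  have l3 : _ = confLen u η := intervalIntegral.integral_add_adjacent_intervals
    (hF.intervalIntegrable 0 (1/2)) (hF.intervalIntegrable (1/2) 1)
  linarith

lemma ibp_ball (u : ℂ → ℝ) (hu : ContDiff ℝ (⊤ : ℕ∞) u) (w : ℂ)
    (φ : ℂ → ℝ) (hφ : ContDiff ℝ (⊤ : ℕ∞) φ) (hφc : HasCompactSupport φ)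
    (hφs : tsupport φ ⊆ ball (0:ℂ) 2) :
    ∫ x in ball (0:ℂ) 2, u x * fderiv ℝ φ x w = -∫ x, φ x • fderiv ℝ u x w := by
  have hd : Differentiable ℝ u := hu.differentiable (by simp)
  have hc : Continuous (fun z => fderiv ℝ u z w) :=
    (hu.continuous_fderiv (by simp)).clm_apply continuous_const
  have hφd : Differentiable ℝ φ := hφ.differentiable (by simp)
  have hφ' : Continuous (fun z => fderiv ℝ φ z w) :=
    (hφ.continuous_fderiv (by simp)).clm_apply continuous_const
  have hφc' : HasCompactSupport (fun z => fderiv ℝ φ z w) := hφc.fderiv_apply (𝕜 := ℝ) w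
  rw [setIntegral_eq_integral_of_forall_compl_eq_zero]
  · rw [integral_mul_fderiv_eq_neg_fderiv_mul_of_integrable]
    · simp only [smul_eq_mul, mul_comm]
    · exact (hc.mul hφ.continuous).integrable_of_hasCompactSupport hφc.mul_left
    · exact (hu.continuous.mul hφ').integrable_of_hasCompactSupport hφc'.mul_left
    · exact (hu.continuous.mul hφ.continuous).integrable_of_hasCompactSupport hφc.mul_left
    · exact fun x _ => hd x
    · exact fun x _ => hφd x
  · intro x hx
    have : fderiv ℝ φ x = 0 := fderiv_of_notMem_tsupport _ (fun h => hx (hφs h))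
    simp [this]

lemma weak_eq (u : ℂ → ℝ) (hu : ContDiff ℝ (⊤ : ℕ∞) u) (V : ℂ → ℂ)
    (hV : IsWeakGradOn (ball (0:ℂ) 2) u V) (w : ℂ)
    (hne : ∃ φ : ℂ → ℝ, ContDiff ℝ (⊤ : ℕ∞) φ ∧ HasCompactSupport φ ∧
      tsupport φ ⊆ ball (0:ℂ) 2 ∧ ∫ x in ball (0:ℂ) 2, u x * fderiv ℝ φ x w ≠ 0) :
    ∀ᵐ x, x ∈ ball (0:ℂ) 2 → dotC (V x) w = fderiv ℝ u x w := by
  obtain ⟨φ₀, h0s, h0c, h0t, h0n⟩ := hne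
  have hc : Continuous (fun z => fderiv ℝ u z w) :=
    (hu.continuous_fderiv (by simp)).clm_apply continuous_const
  have hint0 : ∀ φ : ℂ → ℝ, ContDiff ℝ (⊤ : ℕ∞) φ → HasCompactSupport φ →
      tsupport φ ⊆ ball (0:ℂ) 2 → ∫ x in ball (0:ℂ) 2, u x * fderiv ℝ φ x w ≠ 0 →
      IntegrableOn (fun x => dotC (V x) w * φ x) (ball (0:ℂ) 2) := by
    intro φ h1 h2 h3 h4
    by_contra hcon
    apply h4
    rw [hV φ h1 h2 h3 w, integral_undef hcon, neg_zero]
  have hint : ∀ φ : ℂ → ℝ, ContDiff ℝ (⊤ : ℕ∞) φ → HasCompactSupport φ →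
      tsupport φ ⊆ ball (0:ℂ) 2 →
      IntegrableOn (fun x => dotC (V x) w * φ x) (ball (0:ℂ) 2) := by
    intro φ h1 h2 h3
    by_cases h4 : ∫ x in ball (0:ℂ) 2, u x * fderiv ℝ φ x w = 0
    · have hs : ContDiff ℝ (⊤ : ℕ∞) (φ + φ₀) := h1.add h0s
      have ht : tsupport (φ + φ₀) ⊆ ball (0:ℂ) 2 :=
        (tsupport_add φ φ₀).trans (Set.union_subset h3 h0t)
      have h5 : ∫ x in ball (0:ℂ) 2, u x * fderiv ℝ (φ + φ₀) x w ≠ 0 := by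
        rw [ibp_ball u hu w _ hs (h2.add h0c) ht]
        rw [ibp_ball u hu w _ h1 h2 h3] at h4
        rw [ibp_ball u hu w _ h0s h0c h0t] at h0n
        have : ∫ x, (φ + φ₀) x • fderiv ℝ u x w
            = (∫ x, φ x • fderiv ℝ u x w) + ∫ x, φ₀ x • fderiv ℝ u x w := by
          rw [← integral_add]
          · simp only [Pi.add_apply, add_smul]
          · exact (h1.continuous.smul hc).integrable_of_hasCompactSupport h2.smul_right
          · exact (h0s.continuous.smul hc).integrable_of_hasCompactSupport h0c.smul_right
        rw [this]
        intro h
        apply h0n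
        linarith
      have := (hint0 _ hs (h2.add h0c) ht h5).sub (hint0 _ h0s h0c h0t h0n)
      refine this.congr (Eventually.of_forall fun x => ?_)
      simp [mul_add]
    · exact hint0 φ h1 h2 h3 h4
  have hloc : LocallyIntegrableOn (fun x => dotC (V x) w) (ball (0:ℂ) 2) := by
    intro x hx
    obtain ⟨r, hr, hrs⟩ := Metric.isOpen_ball.mem_nhds hx |> Metric.mem_nhds_iff.1
    let b : ContDiffBump x := ⟨r/4, r/2, by positivity, by linarith⟩
    have hb := hint b b.contDiff b.hasCompactSupport (by
      rw [b.tsupport_eq]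
      exact (closedBall_subset_ball (by change r/2 < r; linarith)).trans hrs)
    refine ⟨ball x (r/4), mem_nhdsWithin_of_mem_nhds (ball_mem_nhds x (by positivity)), ?_⟩
    have hb2 := hb.mono_set ((ball_subset_ball (show r/4 ≤ r by linarith)).trans hrs)
    refine hb2.congr_fun ?_ measurableSet_ball
    intro z hz
    have : b z = 1 := b.one_of_mem_closedBall (ball_subset_closedBall hz)
    simp [this]
  have hfin := IsOpen.ae_eq_zero_of_integral_contDiff_smul_eq_zero (μ := volume)
    (f := fun x => dotC (V x) w - fderiv ℝ u x w)
    (isOpen_ball (x := (0:ℂ)) (ε := 2))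
    (hloc.sub (hc.locallyIntegrable.locallyIntegrableOn _)) ?_
  · filter_upwards [hfin] with x hx hxb
    exact sub_eq_zero.1 (hx hxb)
  · intro g hg hgc hgt
    have h1 := hV g hg hgc hgt w
    rw [ibp_ball u hu w g hg hgc hgt, neg_inj] at h1
    have hz : ∀ x, x ∉ ball (0:ℂ) 2 → dotC (V x) w * g x = 0 := by
      intro x hx
      rw [image_eq_zero_of_notMem_tsupport (fun h => hx (hgt h)), mul_zero]
    have hI := (integrableOn_iff_integrable_of_support_subset (s := ball (0:ℂ) 2) (by
      intro x hx
      by_contra hxb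
      exact hx (hz x hxb))).1 (hint g hg hgc hgt)
    rw [setIntegral_eq_integral_of_forall_compl_eq_zero hz] at h1
    have hI2 : Integrable (fun x => g x • fderiv ℝ u x w) :=
      (hg.continuous.smul hc).integrable_of_hasCompactSupport hgc.smul_right
    have : ∀ x, g x • (dotC (V x) w - fderiv ℝ u x w)
        = dotC (V x) w * g x - g x • fderiv ℝ u x w := by
      intro x
      simp only [smul_eq_mul]
      ring
    simp only [this]
    rw [integral_sub hI hI2, h1, sub_self]

lemma ae_ball_zero (u : ℂ → ℝ) (h0 : ∀ x : ℂ, x ∉ ball (0:ℂ) 2 → u x = 0) :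
    ∀ᵐ x, x ∉ ball (0:ℂ) 2 → fderiv ℝ u x = 0 := by
  have hs : volume (sphere (0:ℂ) 2) = 0 := Measure.addHaar_sphere _ _ _
  have := measure_eq_zero_iff_ae_notMem.1 hs
  filter_upwards [this] with x hx hxb
  apply fderiv_of_notMem_tsupport
  intro hxt
  have hsub : tsupport u ⊆ closedBall (0:ℂ) 2 := by
    refine closure_minimal ?_ isClosed_closedBall
    intro y hy
    by_contra hyc
    exact hy (h0 y fun h => hyc (ball_subset_closedBall h))
  have h1 := hsub hxt
  rw [← ball_union_sphere] at h1
  exact h1.elim hxb hx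

lemma grad_l1 (u : ℂ → ℝ) (hu : ContDiff ℝ (⊤ : ℕ∞) u)
    (h0 : ∀ x : ℂ, x ∉ ball (0:ℂ) 2 → u x = 0) (V : ℂ → ℂ)
    (hV : IsWeakGradOn (ball (0:ℂ) 2) u V) (C : ℝ)
    (hC : (∫ x in ball (0:ℂ) 2, |u x| ^ (3/2:ℝ)) ^ (1/(3/2:ℝ))
        + (∫ x in ball (0:ℂ) 2, ‖V x‖ ^ (3/2:ℝ)) ^ (1/(3/2:ℝ)) ≤ C) (w : ℂ)
    (hw : w = 1 ∨ w = Complex.I) :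
    ∫ z, |fderiv ℝ u z w| ≤ volume.real (ball (0:ℂ) 2) + C ^ (3/2:ℝ) := by
  have hd : Differentiable ℝ u := hu.differentiable (by simp)
  have hfc : Continuous (fderiv ℝ u) := hu.continuous_fderiv (by simp)
  have hc : ∀ w, Continuous (fun z => fderiv ℝ u z w) := fun w =>
    hfc.clm_apply continuous_const
  have hcs : HasCompactSupport u := by
    refine HasCompactSupport.intro (isCompact_closedBall (0:ℂ) 2) ?_
    intro x hx
    exact h0 x (fun h => hx (ball_subset_closedBall h))
  have hJ0 : 0 ≤ ∫ x in ball (0:ℂ) 2, ‖V x‖ ^ (3/2:ℝ) := by positivity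
  have hI0 : 0 ≤ ∫ x in ball (0:ℂ) 2, |u x| ^ (3/2:ℝ) := by positivity
  have hI1 := Real.rpow_nonneg hI0 (1/(3/2:ℝ))
  have hJ1 := Real.rpow_nonneg hJ0 (1/(3/2:ℝ))
  have hC0 : 0 ≤ C := by linarith
  have hCJ : ∫ x in ball (0:ℂ) 2, ‖V x‖ ^ (3/2:ℝ) ≤ C ^ (3/2:ℝ) := by
    have h1 : (∫ x in ball (0:ℂ) 2, ‖V x‖ ^ (3/2:ℝ)) ^ (1/(3/2:ℝ)) ≤ C := by linarith
    have h2 := Real.rpow_le_rpow hJ1 h1 (show (0:ℝ) ≤ 3/2 by norm_num)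
    rw [← Real.rpow_mul hJ0] at h2
    norm_num at h2 ⊢
    exact h2
  have hae0 := ae_ball_zero u h0
  by_cases hu0 : u = 0
  · have : ∀ z, fderiv ℝ u z w = 0 := by
      intro z; rw [hu0]; simp
    simp only [this, abs_zero, integral_zero]
    positivity
  have hne : ∀ w : ℂ, w ≠ 0 → ∃ φ : ℂ → ℝ, ContDiff ℝ (⊤ : ℕ∞) φ ∧ HasCompactSupport φ ∧
      tsupport φ ⊆ ball (0:ℂ) 2 ∧ ∫ x in ball (0:ℂ) 2, u x * fderiv ℝ φ x w ≠ 0 := by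
    intro w hw
    by_contra hcon
    push Not at hcon
    apply hu0
    have h1 := IsOpen.ae_eq_zero_of_integral_contDiff_smul_eq_zero (μ := volume)
      (f := fun x => fderiv ℝ u x w)
      (isOpen_ball (x := (0:ℂ)) (ε := 2))
      ((hc w).locallyIntegrable.locallyIntegrableOn _) (by
        intro g hg hgc hgt
        have h2 := hcon g hg hgc hgt
        rw [ibp_ball u hu w g hg hgc hgt] at h2
        linarith)
    have h2 : (fun x => fderiv ℝ u x w) = fun _ => 0 := by
      refine (Continuous.ae_eq_iff_eq volume (hc w) continuous_const).1 ?_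
      filter_upwards [h1, hae0] with x hx1 hx2
      by_cases hx : x ∈ ball (0:ℂ) 2
      · exact hx1 hx
      · simp [hx2 hx]
    funext x
    have hder : ∀ t : ℝ, HasDerivAt (fun t : ℝ => u (x + t • w)) 0 t := by
      intro t
      have h3 : HasDerivAt (fun t : ℝ => x + t • w) w t := by
        simpa using ((hasDerivAt_id t).smul_const w).const_add x
      have h4 := (hd _).hasFDerivAt.comp_hasDerivAt t h3
      have h5 := congrFun h2 (x + t • w)
      rwa [h5] at h4
    have hconst := is_const_of_deriv_eq_zero (fun t => (hder t).differentiableAt)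
      (fun t => (hder t).deriv) 0 ((2 + ‖x‖) / ‖w‖)
    simp only [zero_smul, add_zero] at hconst
    rw [hconst, Pi.zero_apply]
    apply h0
    rw [mem_ball_zero_iff, not_lt]
    have hw' : 0 < ‖w‖ := norm_pos_iff.2 hw
    have h6 : ‖((2 + ‖x‖) / ‖w‖) • w‖ = 2 + ‖x‖ := by
      rw [norm_smul, Real.norm_of_nonneg (by positivity)]
      field_simp
    have h7 := norm_sub_le (x + ((2 + ‖x‖) / ‖w‖) • w) x
    rw [add_sub_cancel_left, h6] at h7
    linarith
  have hV1 := weak_eq u hu V hV 1 (hne 1 one_ne_zero)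
  have hVI := weak_eq u hu V hV Complex.I (hne _ Complex.I_ne_zero)
  set W : ℂ → ℂ := fun z => ⟨fderiv ℝ u z 1, fderiv ℝ u z Complex.I⟩ with hW
  have hWc : Continuous W := by
    have : W = fun z => ((fderiv ℝ u z 1 : ℝ) : ℂ) + ((fderiv ℝ u z Complex.I : ℝ) : ℂ) * Complex.I := by
      funext z
      apply Complex.ext <;> simp [hW]
    rw [this]
    exact ((Complex.continuous_ofReal.comp (hc 1))).add
      ((Complex.continuous_ofReal.comp (hc _)).mul continuous_const)
  have hVW : ∀ᵐ x, x ∈ ball (0:ℂ) 2 → V x = W x := by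
    filter_upwards [hV1, hVI] with x h1 h2 hx
    have h1 := h1 hx
    have h2 := h2 hx
    simp only [dotC, Complex.one_re, Complex.one_im, Complex.I_re, Complex.I_im, mul_one, mul_zero,
      add_zero, zero_add] at h1 h2
    exact Complex.ext h1 h2
  have hJW : ∫ x in ball (0:ℂ) 2, ‖V x‖ ^ (3/2:ℝ) = ∫ x in ball (0:ℂ) 2, ‖W x‖ ^ (3/2:ℝ) := by
    refine setIntegral_congr_ae measurableSet_ball ?_
    filter_upwards [hVW] with x hx hxb
    rw [hx hxb]
  have hwW : ∀ z, |fderiv ℝ u z w| ≤ ‖W z‖ := by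
    intro z
    rcases hw with rfl | rfl
    · exact Complex.abs_re_le_norm (W z)
    · exact Complex.abs_im_le_norm (W z)
  have hWp : Continuous (fun z => ‖W z‖ ^ (3/2:ℝ)) :=
    hWc.norm.rpow_const (fun _ => Or.inr (by norm_num))
  have hon : ∀ F : ℂ → ℝ, Continuous F → IntegrableOn F (ball (0:ℂ) 2) := fun F hF =>
    (hF.continuousOn.integrableOn_compact (isCompact_closedBall (0:ℂ) 2)).mono_set
      ball_subset_closedBall
  calc ∫ z, |fderiv ℝ u z w| = ∫ z in ball (0:ℂ) 2, |fderiv ℝ u z w| := by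
        symm
        apply setIntegral_eq_integral_of_ae_compl_eq_zero
        filter_upwards [hae0] with x hx hxb
        simp [hx hxb]
    _ ≤ ∫ z in ball (0:ℂ) 2, (1 + ‖W z‖ ^ (3/2:ℝ)) := by
        refine setIntegral_mono (hon _ (hc w).abs) (hon _ (continuous_const.add hWp)) ?_
        intro z
        refine (hwW z).trans ?_
        rcases le_total ‖W z‖ 1 with h | h
        · have := Real.rpow_nonneg (norm_nonneg (W z)) (3/2:ℝ)
          simp only
          linarith
        · have := Real.rpow_le_rpow_of_exponent_le h (show (1:ℝ) ≤ 3/2 by norm_num)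
          rw [Real.rpow_one] at this
          simp only
          linarith
    _ = volume.real (ball (0:ℂ) 2) + ∫ x in ball (0:ℂ) 2, ‖W x‖ ^ (3/2:ℝ) := by
        rw [integral_add (hon _ continuous_const) (hon _ hWp)]
        simp
    _ ≤ _ := by
        rw [← hJW]
        gcongr

lemma dist_lower (u : ℂ → ℝ) (hu : ContDiff ℝ (⊤ : ℕ∞) u)
    (h0 : ∀ x : ℂ, x ∉ ball (0:ℂ) 2 → u x = 0) (B A : ℝ) (hA : 0 ≤ A)
    (hB : ∀ w : ℂ, w = 1 ∨ w = Complex.I → ∫ z, |fderiv ℝ u z w| ≤ B)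
    (δ : ℝ) (x y : ℂ) (hxy : δ ≤ ‖x - y‖) :
    Real.exp (-A) * (δ / 2 * (1 + A) - B) ≤ confDist u Set.univ x y := by
  apply confDist_ge
  rintro γ ⟨g0, g1, -, hγ⟩
  have hcase : δ / 2 ≤ |y.re - x.re| ∨ δ / 2 ≤ |y.im - x.im| := by
    by_contra hcon
    push Not at hcon
    have := Complex.norm_le_abs_re_add_abs_im (x - y)
    rw [Complex.sub_re, Complex.sub_im, abs_sub_comm, abs_sub_comm x.im] at this
    linarith [hcon.1, hcon.2]
  rcases hcase with h | h
  · obtain ⟨G, hG, hGu, hGB⟩ := slice_bound u hu h0 1 Complex.I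
      (fun a b => by simpa using Complex.abs_im_le_norm (a • (1:ℂ) + b • Complex.I)) coordI
    have := len_lower u hu.continuous Complex.reCLM Complex.abs_re_le_norm G hG
      (fun z => by
        have := hGu z.re z.im
        simpa using this) B A
      (fun s t hst => (hGB s t hst).trans (hB _ (Or.inr rfl))) γ hγ
    refine le_trans ?_ this
    rw [g0, g1]
    simp only [Complex.reCLM_apply]
    gcongr
  · obtain ⟨G, hG, hGu, hGB⟩ := slice_bound u hu h0 Complex.I 1
      (fun a b => by simpa using Complex.abs_re_le_norm (a • Complex.I + b • (1:ℂ))) coord1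
    have := len_lower u hu.continuous Complex.imCLM Complex.abs_im_le_norm G hG
      (fun z => by
        have := hGu z.im z.re
        rw [add_comm] at this
        simpa using this) B A
      (fun s t hst => (hGB s t hst).trans (hB _ (Or.inl rfl))) γ hγ
    refine le_trans ?_ this
    rw [g0, g1]
    simp only [Complex.imCLM_apply]
    gcongr

/-- the limit `d₀` of the distances `d_{g_k}` is a distance function, and is
uniformly positive on pairs of points at definite Euclidean distance. -/
theorem statement14 :
    ∃ ε₀ : ℝ, 0 < ε₀ ∧
      ∀ (u : ℕ → ℂ → ℝ) (u₀ : ℂ → ℝ) (d₀ : ℂ → ℂ → ℝ),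
        (∀ k, ContDiff ℝ (⊤ : ℕ∞) (u k)) →
        (∀ k, ∀ x : ℂ, x ∉ ball (0:ℂ) 2 → u k x = 0) →
        (∀ p : ℝ, 1 < p → p < 2 → WeakW1pLim (ball (0:ℂ) 2) p u u₀) →
        (∀ k, curvIntE (u k) (ball (0:ℂ) 1) < ENNReal.ofReal ε₀) →
        (∀ ε : ℝ, 0 < ε → ∀ᶠ k in atTop, ∀ x ∈ ball (0:ℂ) 1, ∀ y ∈ ball (0:ℂ) 1,
          |confDist (u k) Set.univ x y - d₀ x y| < ε) →
        ((∀ x ∈ ball (0:ℂ) 1, ∀ y ∈ ball (0:ℂ) 1,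
            0 ≤ d₀ x y ∧ (d₀ x y = 0 ↔ x = y) ∧ d₀ x y = d₀ y x) ∧
         (∀ x ∈ ball (0:ℂ) 1, ∀ y ∈ ball (0:ℂ) 1, ∀ z ∈ ball (0:ℂ) 1,
            d₀ x z ≤ d₀ x y + d₀ y z) ∧
         (∀ δ : ℝ, 0 < δ → ∃ a : ℝ, 0 < a ∧
            ∀ x ∈ ball (0:ℂ) 1, ∀ y ∈ ball (0:ℂ) 1,
              δ ≤ ‖x - y‖ → a < d₀ x y)) := by
  refine ⟨1, one_pos, ?_⟩
  intro u u₀ d₀ hu h0 hW _ hconv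
  obtain ⟨V, hV, ⟨C, hC⟩, -⟩ := hW (3/2) (by norm_num) (by norm_num)
  set B := volume.real (ball (0:ℂ) 2) + C ^ (3/2:ℝ) with hBdef
  have hB : ∀ k, ∀ w : ℂ, w = 1 ∨ w = Complex.I → ∫ z, |fderiv ℝ (u k) z w| ≤ B :=
    fun k w hw => grad_l1 (u k) (hu k) (h0 k) (V k) (hV k) C (hC k) w hw
  have hlim : ∀ x ∈ ball (0:ℂ) 1, ∀ y ∈ ball (0:ℂ) 1,
      Tendsto (fun k => confDist (u k) Set.univ x y) atTop (𝓝 (d₀ x y)) := by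
    intro x hx y hy
    rw [Metric.tendsto_atTop']
    intro ε hε
    obtain ⟨N, hN⟩ := eventually_atTop.1 (hconv ε hε)
    exact ⟨N, fun n hn => by rw [Real.dist_eq]; exact hN n hn.le x hx y hy⟩
  have hpos : ∀ δ : ℝ, 0 < δ → ∃ a : ℝ, 0 < a ∧
      ∀ x ∈ ball (0:ℂ) 1, ∀ y ∈ ball (0:ℂ) 1, δ ≤ ‖x - y‖ → a < d₀ x y := by
    intro δ hδ
    have hB0 : 0 ≤ B := (integral_nonneg fun _ => abs_nonneg _).trans (hB 0 1 (Or.inl rfl))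
    set A := 2 * B / δ with hAdef
    have hA : 0 ≤ A := by positivity
    refine ⟨Real.exp (-A) * (δ / 4), by positivity, ?_⟩
    intro x hx y hy hxy
    have h1 : Real.exp (-A) * (δ / 2 * (1 + A) - B) ≤ d₀ x y :=
      ge_of_tendsto' (hlim x hx y hy) fun k =>
        dist_lower (u k) (hu k) (h0 k) B A hA (hB k) δ x y hxy
    refine lt_of_lt_of_le ?_ h1
    have h2 : δ / 2 * (1 + A) - B = δ / 2 := by
      rw [hAdef]; field_simp; ring
    rw [h2]
    gcongr
    norm_num
  refine ⟨?_, ?_, hpos⟩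
  · intro x hx y hy
    refine ⟨ge_of_tendsto' (hlim x hx y hy) fun k => confDist_nonneg' _ _ _, ⟨?_, ?_⟩, ?_⟩
    · intro h
      by_contra hne
      obtain ⟨a, ha, hh⟩ := hpos ‖x - y‖ (norm_pos_iff.2 (sub_ne_zero.2 hne))
      have := hh x hx y hy le_rfl
      linarith
    · rintro rfl
      refine tendsto_nhds_unique (hlim x hx x hx) ?_
      simp only [confDist_self']
      exact tendsto_const_nhds
    · refine tendsto_nhds_unique (hlim x hx y hy) ?_
      refine (hlim y hy x hx).congr fun k => ?_
      exact le_antisymm (confDist_symm_le _ _ _) (confDist_symm_le _ _ _)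
  · intro x hx y hy z hz
    exact le_of_tendsto_of_tendsto' (hlim x hx z hz) ((hlim x hx y hy).add (hlim y hy z hz))
      fun k => confDist_triangle' (u k) (hu k).continuous x y z
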